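/- Let p, q ∈ (1,∞) and 0 ≤ k < l < 1. Then for every t ∈ (0,1]: (i) F_{pq,k}(t) < F_{pq,l}(t), and (ii) F_{pq,l}(t)/K_{pq}(l) ≤ F_{pq,k}(t)/K_{pq}(k). (Equivalently, the generalized Jacobian elliptic function k ↦ sn_{pq}(2K_{pq}(k)x, k) is increasing in k for each fixed x ∈ [0,1].) -/

import Mathlib

open Real intervalIntegral

noncomputable def Kpq (p q k : ℝ) : ℝ :=
  ∫ t in (0:ℝ)..1, (1 - t ^ q) ^ (-(1 / p)) * (1 - k ^ q * t ^ q) ^ (-(1 / (p / (p - 1))))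

/-- `F_{pq,k}(y) = ∫₀^y (1−t^q)^{−1/p}(1−k^q t^q)^{−1/p'} dt`, the inverse of `sn_{pq}(·,k)`. -/
noncomputable def Fpq (p q k y : ℝ) : ℝ :=
  ∫ t in (0:ℝ)..y, (1 - t ^ q) ^ (-(1 / p)) * (1 - k ^ q * t ^ q) ^ (-(1 / (p / (p - 1))))

theorem intervalIntegrable_one_sub_rpow_rpow {p q : ℝ} (hp : 1 < p) (hq : 1 < q) :
    IntervalIntegrable (fun s : ℝ => (1 - s ^ q) ^ (-(1 / p))) MeasureTheory.volume 0 1 := by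
  have hp0 : 0 < 1 / p := by positivity
  have hp1 : 1 / p < 1 := by rw [div_lt_one (by linarith)]; exact hp
  have hmaj : IntervalIntegrable (fun s : ℝ => (1 - s) ^ (-(1 / p)))
      MeasureTheory.volume 0 1 := by
    have h := (intervalIntegrable_rpow' (a := 0) (b := 1)
      (show -1 < -(1 / p) by linarith)).comp_sub_left 1
    simpa using h.symm
  refine hmaj.mono_fun
    (((measurable_id.pow_const q).const_sub 1).pow_const _).aestronglyMeasurable ?_
  rw [Set.uIoc_of_le zero_le_one]
  refine (MeasureTheory.ae_restrict_mem measurableSet_Ioc).mono fun s hs => ?_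
  have hsq : s ^ q ≤ s := by
    simpa using rpow_le_rpow_of_exponent_ge hs.1 hs.2 hq.le
  rcases hs.2.eq_or_lt with rfl | hs1
  · simp
  · beta_reduce
    rw [norm_of_nonneg (rpow_nonneg (by linarith) _),
      norm_of_nonneg (rpow_nonneg (by linarith) _)]
    exact rpow_le_rpow_of_nonpos (by linarith) (by linarith) (by linarith)

theorem one_sub_rpow_mul_rpow_pos {q k s : ℝ} (hq : 0 < q) (hk0 : 0 ≤ k) (hk1 : k < 1)
    (hs0 : 0 ≤ s) (hs1 : s ≤ 1) : 0 < 1 - k ^ q * s ^ q := by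
  have hk := rpow_lt_one hk0 hk1 hq
  have hs := rpow_le_one hs0 hs1 hq.le
  nlinarith [rpow_nonneg hk0 q, rpow_nonneg hs0 q]

theorem intervalIntegrable_Fpq_integrand {p q k : ℝ} (hp : 1 < p) (hq : 1 < q)
    (hk0 : 0 ≤ k) (hk1 : k < 1) :
    IntervalIntegrable (fun s : ℝ => (1 - s ^ q) ^ (-(1 / p)) *
      (1 - k ^ q * s ^ q) ^ (-(1 / (p / (p - 1))))) MeasureTheory.volume 0 1 := by
  refine (intervalIntegrable_one_sub_rpow_rpow hp hq).mul_continuousOn ?_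
  rw [Set.uIcc_of_le zero_le_one]
  refine ContinuousOn.rpow_const ?_ fun s hs =>
    Or.inl (one_sub_rpow_mul_rpow_pos (by linarith) hk0 hk1 hs.1 hs.2).ne'
  exact (continuous_const.sub
    (continuous_const.mul (continuous_id.rpow_const fun _ => Or.inr (by linarith)))).continuousOn

theorem one_sub_mul_rpow_neg_mul_le {q k l c s t : ℝ} (hq : 0 < q) (hc : 0 ≤ c)
    (hk0 : 0 ≤ k) (hkl : k ≤ l) (hl1 : l < 1) (hs0 : 0 ≤ s) (hst : s ≤ t) (ht1 : t ≤ 1) :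
    (1 - l ^ q * s ^ q) ^ (-c) * (1 - k ^ q * t ^ q) ^ (-c) ≤
      (1 - l ^ q * t ^ q) ^ (-c) * (1 - k ^ q * s ^ q) ^ (-c) := by
  have hls := one_sub_rpow_mul_rpow_pos hq (hk0.trans hkl) hl1 hs0 (hst.trans ht1)
  have hks := one_sub_rpow_mul_rpow_pos hq hk0 (hkl.trans_lt hl1) hs0 (hst.trans ht1)
  have hlt := one_sub_rpow_mul_rpow_pos hq (hk0.trans hkl) hl1 (hs0.trans hst) ht1
  have hkt := one_sub_rpow_mul_rpow_pos hq hk0 (hkl.trans_lt hl1) (hs0.trans hst) ht1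
  rw [← mul_rpow hls.le hkt.le, ← mul_rpow hlt.le hks.le]
  refine rpow_le_rpow_of_nonpos (mul_pos hlt hks) ?_ (by linarith)
  have h₁ := rpow_le_rpow hk0 hkl hq.le
  have h₂ := rpow_le_rpow hs0 hst hq.le
  nlinarith [mul_nonneg (sub_nonneg.2 h₁) (sub_nonneg.2 h₂)]

theorem Fpq_pos {p q k t : ℝ} (hp : 1 < p) (hq : 1 < q) (hk0 : 0 ≤ k) (hk1 : k < 1)
    (ht0 : 0 < t) (ht1 : t ≤ 1) : 0 < Fpq p q k t := by
  refine intervalIntegral_pos_of_pos_on ?_ (fun s hs => ?_) ht0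
  · refine (intervalIntegrable_Fpq_integrand hp hq hk0 hk1).mono_set ?_
    rw [Set.uIcc_of_le ht0.le, Set.uIcc_of_le zero_le_one]
    exact Set.Icc_subset_Icc_right ht1
  · have hs1 : s < 1 := hs.2.trans_le ht1
    have h₁ := rpow_lt_one hs.1.le hs1 (show 0 < q by linarith)
    have h₂ := one_sub_rpow_mul_rpow_pos (show 0 < q by linarith) hk0 hk1 hs.1.le hs1.le
    exact mul_pos (rpow_pos_of_pos (by linarith) _) (rpow_pos_of_pos h₂ _)

theorem stmt8 (p q k l : ℝ) (hp : 1 < p) (hq : 1 < q)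
    (hk0 : 0 ≤ k) (hkl : k < l) (hl1 : l < 1) (t : ℝ) (ht0 : 0 < t) (ht1 : t ≤ 1) :
    Fpq p q k t < Fpq p q l t ∧
    Fpq p q l t / Kpq p q l ≤ Fpq p q k t / Kpq p q k := by
  have hq0 : 0 < q := by linarith
  have hk1 : k < 1 := hkl.trans hl1
  have hl0 : 0 ≤ l := hk0.trans hkl.le
  have hc : 0 < 1 / (p / (p - 1)) := by
    have : 0 < p - 1 := by linarith
    positivity
  have hleft : Set.uIcc 0 t ⊆ Set.uIcc (0 : ℝ) 1 := by
    rw [Set.uIcc_of_le ht0.le, Set.uIcc_of_le zero_le_one]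
    exact Set.Icc_subset_Icc_right ht1
  have hright : Set.uIcc t 1 ⊆ Set.uIcc (0 : ℝ) 1 := by
    rw [Set.uIcc_of_le ht1, Set.uIcc_of_le zero_le_one]
    exact Set.Icc_subset_Icc_left ht0.le
  have hk := intervalIntegrable_Fpq_integrand hp hq hk0 hk1
  have hl := intervalIntegrable_Fpq_integrand hp hq hl0 hl1
  have hkA := hk.mono_set hleft
  have hlA := hl.mono_set hleft
  have hkB := hk.mono_set hright
  have hlB := hl.mono_set hright
  constructor
  · rw [← sub_pos, Fpq, Fpq, ← integral_sub hlA hkA]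
    refine intervalIntegral_pos_of_pos_on (hlA.sub hkA) (fun s hs => ?_) ht0
    have hs1 : s < 1 := hs.2.trans_le ht1
    have h₁ := rpow_lt_one hs.1.le hs1 hq0
    have h₂ := one_sub_rpow_mul_rpow_pos hq0 hl0 hl1 hs.1.le hs1.le
    have h₃ := mul_lt_mul_of_pos_right (rpow_lt_rpow hk0 hkl hq0) (rpow_pos_of_pos hs.1 q)
    exact sub_pos.2 (mul_lt_mul_of_pos_left
      (rpow_lt_rpow_of_neg h₂ (by linarith) (by linarith))
      (rpow_pos_of_pos (by linarith) _))
  · have hKk : 0 < Kpq p q k := Fpq_pos hp hq hk0 hk1 one_pos le_rfl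
    have hKl : 0 < Kpq p q l := Fpq_pos hp hq hl0 hl1 one_pos le_rfl
    have hAk := Fpq_pos hp hq hk0 hk1 ht0 ht1
    rw [div_le_div_iff₀ hKl hKk, Kpq, Kpq, ← integral_add_adjacent_intervals hkA hkB,
      ← integral_add_adjacent_intervals hlA hlB]
    simp only [Fpq] at hAk ⊢
    set gk := (1 - k ^ q * t ^ q) ^ (-(1 / (p / (p - 1)))) with hgk
    set gl := (1 - l ^ q * t ^ q) ^ (-(1 / (p / (p - 1)))) with hgl
    have hgk0 : 0 < gk := rpow_pos_of_pos (one_sub_rpow_mul_rpow_pos hq0 hk0 hk1 ht0.le ht1) _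
    have hgl0 : 0 < gl := rpow_pos_of_pos (one_sub_rpow_mul_rpow_pos hq0 hl0 hl1 ht0.le ht1) _
    have hf0 {s : ℝ} (hs0 : 0 ≤ s) (hs1 : s ≤ 1) : 0 ≤ (1 - s ^ q) ^ (-(1 / p)) :=
      rpow_nonneg (sub_nonneg.2 (rpow_le_one hs0 hs1 hq0.le)) _
    have hA := integral_mono_on ht0.le (hlA.const_mul gk) (hkA.const_mul gl) fun s hs => by
      have h := mul_le_mul_of_nonneg_left
        (one_sub_mul_rpow_neg_mul_le hq0 hc.le hk0 hkl.le hl1 hs.1 hs.2 ht1)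
        (hf0 hs.1 (hs.2.trans ht1))
      rw [← hgk, ← hgl] at h
      linarith
    have hB := integral_mono_on ht1 (hkB.const_mul gl) (hlB.const_mul gk) fun s hs => by
      have h := mul_le_mul_of_nonneg_left
        (one_sub_mul_rpow_neg_mul_le hq0 hc.le hk0 hkl.le hl1 ht0.le hs.1 hs.2)
        (hf0 (ht0.le.trans hs.1) hs.2)
      rw [← hgk, ← hgl] at h
      linarith
    have hBk : 0 ≤ ∫ s in t..1, (1 - s ^ q) ^ (-(1 / p)) *
        (1 - k ^ q * s ^ q) ^ (-(1 / (p / (p - 1)))) :=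
      integral_nonneg ht1 fun s hs => mul_nonneg (hf0 (ht0.le.trans hs.1) hs.2)
        (rpow_nonneg (one_sub_rpow_mul_rpow_pos hq0 hk0 hk1 (ht0.le.trans hs.1) hs.2).le _)
    simp only [integral_const_mul] at hA hB
    rw [mul_add, mul_add]
    have h₁ := mul_le_mul_of_nonneg_right hA hBk
    have h₂ := mul_le_mul_of_nonneg_left hB hAk.le
    refine le_of_mul_le_mul_left ?_ hgk0
    linarith
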